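/- arXiv:2105.08303 — 5 statements merged into one kernel-verified Lean document; each statement's English description precedes it below -/
import Mathlib

section
/- Let (P_t) be a quantum Markov semigroup on M_n(ℂ) with generator L, and let K ∈ ℝ and N ∈ (0,∞]. The following are equivalent: (a) for every t ≥ 0 and every a ∈ M_n(ℂ), Γ(P_t a) ≤ e^{−2Kt}·P_t(Γ(a)) − (c_K(t)/N)·|L P_t a|², where c_K(t) = (1−e^{−2Kt})/K for K ≠ 0 and c_0(t) = 2t; (b) for every a ∈ M_n(ℂ), Γ₂(a) ≥ K·Γ(a) + (1/N)·|L a|². (If this holds, (P_t) is said to satisfy the Bakry–Émery curvature-dimension condition BE(K,N).) -/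
open Matrix Filter
open scoped ComplexOrder ENNReal Kronecker

namespace CD

abbrev Mat (ι : Type*) := Matrix ι ι ℂ

variable {ι : Type*}

noncomputable def trn [Fintype ι] (x : Mat ι) : ℂ :=
  (Fintype.card ι : ℂ)⁻¹ * x.trace

noncomputable def inn [Fintype ι] (x y : Mat ι) : ℂ := trn (xᴴ * y)

def matLE [Fintype ι] (A B : Mat ι) : Prop := (B - A).PosSemidef

def blockify [Fintype ι] {m : ℕ} (B : Fin m → Fin m → Mat ι) :
    Matrix (Fin m × ι) (Fin m × ι) ℂ :=
  Matrix.of fun p q => B p.1 q.1 p.2 q.2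

def IsCP [Fintype ι] (Φ : Mat ι →ₗ[ℂ] Mat ι) : Prop :=
  ∀ (m : ℕ) (B : Fin m → Fin m → Mat ι),
    (blockify B).PosSemidef → (blockify fun j k => Φ (B j k)).PosSemidef

structure QMS (ι : Type*) [Fintype ι] [DecidableEq ι] where
  P : ℝ → Mat ι →ₗ[ℂ] Mat ι
  gen : Mat ι →ₗ[ℂ] Mat ι
  P_zero : P 0 = LinearMap.id
  P_add : ∀ s t : ℝ, P (s + t) = (P s) ∘ₗ (P t)
  P_cp : ∀ t : ℝ, 0 ≤ t → IsCP (P t)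
  P_unital : ∀ t : ℝ, 0 ≤ t → P t 1 = 1
  P_cont : ∀ (x : Mat ι) (i j : ι), Continuous fun t : ℝ => P t x i j
  P_deriv : ∀ (x : Mat ι) (i j : ι),
    HasDerivAt (fun t : ℝ => P t x i j) (-(gen x i j)) 0

variable [Fintype ι] [DecidableEq ι]

def TraciallySymm (Q : QMS ι) : Prop :=
  ∀ t : ℝ, 0 ≤ t → ∀ x y : Mat ι, trn (Q.P t x * y) = trn (x * Q.P t y)

noncomputable def Gamma (L : Mat ι →ₗ[ℂ] Mat ι) (a b : Mat ι) : Mat ι :=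
  (2:ℂ)⁻¹ • (aᴴ * L b + (L a)ᴴ * b - L (aᴴ * b))

noncomputable def Gamma2 (L : Mat ι →ₗ[ℂ] Mat ι) (a b : Mat ι) : Mat ι :=
  (2:ℂ)⁻¹ • (Gamma L a (L b) + Gamma L (L a) b - L (Gamma L a b))

noncomputable def BE (L : Mat ι →ₗ[ℂ] Mat ι) (K ν : ℝ) : Prop :=
  ∀ a : Mat ι, matLE (K • Gamma L a a + ν • ((L a)ᴴ * (L a))) (Gamma2 L a a)

noncomputable def cK (K t : ℝ) : ℝ :=
  if K = 0 then 2 * t else (1 - Real.exp (-(2 * K * t))) / K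

noncomputable def comm (v x : Mat ι) : Mat ι := v * x - x * v

def LindbladForm (L : Mat ι →ₗ[ℂ] Mat ι) {d : ℕ} (v : Fin d → Mat ι) : Prop :=
  (∀ j, ∃ k, (v j)ᴴ = v k) ∧ ∀ x, L x = ∑ j, comm ((v j)ᴴ) (comm (v j) x)

def Intertwining (Q : QMS ι) {d : ℕ} (v : Fin d → Mat ι) (K : ℝ) : Prop :=
  ∀ t : ℝ, 0 ≤ t → ∀ (j : Fin d) (x : Mat ι),
    comm (v j) (Q.P t x) = Real.exp (-(K * t)) • Q.P t (comm (v j) x)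

def CBE (L : Mat ι →ₗ[ℂ] Mat ι) (K ν : ℝ) : Prop :=
  ∀ (m : ℕ) (x : Fin m → Mat ι),
    (blockify (fun j k => Gamma2 L (x j) (x k)) -
      (K • blockify (fun j k => Gamma L (x j) (x k)) +
       ν • blockify (fun j k => (L (x j))ᴴ * (L (x k))))).PosSemidef

def IsDensity (ρ : Mat ι) : Prop := ρ.PosSemidef ∧ trn ρ = 1

def IsInvDensity (ρ : Mat ι) : Prop := ρ.PosDef ∧ trn ρ = 1

def sliceL {κ : Type*} (x : Mat (ι × κ)) (a b : κ) : Mat ι :=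
  Matrix.of fun i j => x (i, a) (j, b)

def sliceR {κ : Type*} (x : Mat (κ × ι)) (a b : κ) : Mat ι :=
  Matrix.of fun i j => x (a, i) (b, j)

noncomputable def lTensor (Φ : Mat ι →ₗ[ℂ] Mat ι) (κ : Type*) :
    Mat (ι × κ) →ₗ[ℂ] Mat (ι × κ) where
  toFun x := Matrix.of fun p q => Φ (sliceL x p.2 q.2) p.1 q.1
  map_add' x y := by
    ext p q
    have h : sliceL (x + y) p.2 q.2 = sliceL x p.2 q.2 + sliceL y p.2 q.2 := rfl
    simp only [Matrix.of_apply, h, map_add, Matrix.add_apply]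
  map_smul' c x := by
    ext p q
    have h : sliceL (c • x) p.2 q.2 = c • sliceL x p.2 q.2 := rfl
    simp only [Matrix.of_apply, h, _root_.map_smul, Matrix.smul_apply, RingHom.id_apply]

noncomputable def rTensor (Ψ : Mat ι →ₗ[ℂ] Mat ι) (κ : Type*) :
    Mat (κ × ι) →ₗ[ℂ] Mat (κ × ι) where
  toFun x := Matrix.of fun p q => Ψ (sliceR x p.1 q.1) p.2 q.2
  map_add' x y := by
    ext p q
    have h : sliceR (x + y) p.1 q.1 = sliceR x p.1 q.1 + sliceR y p.1 q.1 := rfl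
    simp only [Matrix.of_apply, h, map_add, Matrix.add_apply]
  map_smul' c x := by
    ext p q
    have h : sliceR (c • x) p.1 q.1 = c • sliceR x p.1 q.1 := rfl
    simp only [Matrix.of_apply, h, _root_.map_smul, Matrix.smul_apply, RingHom.id_apply]

end CD

namespace CD

section EntrywiseCalculus

variable {n : ℕ}

/-- Entrywise differentiability of a curve of matrices. -/
def HasEntryDerivAt (f : ℝ → Mat (Fin n)) (f' : Mat (Fin n)) (t : ℝ) : Prop :=
  ∀ i j, HasDerivAt (fun s => f s i j) (f' i j) t

lemma linearMap_apply_eq_sum {V : Type*} [AddCommGroup V] [Module ℂ V]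
    (Φ : Mat (Fin n) →ₗ[ℂ] V) (X : Mat (Fin n)) :
    Φ X = ∑ i, ∑ j, X i j • Φ (single i j 1) := by
  conv_lhs => rw [matrix_eq_sum_single X]
  simp only [map_sum, ← _root_.map_smul, smul_single, smul_eq_mul, mul_one]

lemma HasEntryDerivAt.congr_deriv {f : ℝ → Mat (Fin n)} {f' g' : Mat (Fin n)} {t : ℝ}
    (h : HasEntryDerivAt f f' t) (e : f' = g') : HasEntryDerivAt f g' t := e ▸ h

lemma HasEntryDerivAt.const (X : Mat (Fin n)) (t : ℝ) :
    HasEntryDerivAt (fun _ => X) 0 t := fun _ _ => hasDerivAt_const _ _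

lemma HasEntryDerivAt.add {f g : ℝ → Mat (Fin n)} {f' g' : Mat (Fin n)} {t : ℝ}
    (hf : HasEntryDerivAt f f' t) (hg : HasEntryDerivAt g g' t) :
    HasEntryDerivAt (fun s => f s + g s) (f' + g') t :=
  fun i j => (hf i j).add (hg i j)

lemma HasEntryDerivAt.sub {f g : ℝ → Mat (Fin n)} {f' g' : Mat (Fin n)} {t : ℝ}
    (hf : HasEntryDerivAt f f' t) (hg : HasEntryDerivAt g g' t) :
    HasEntryDerivAt (fun s => f s - g s) (f' - g') t :=
  fun i j => (hf i j).sub (hg i j)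

lemma HasEntryDerivAt.const_smul {f : ℝ → Mat (Fin n)} {f' : Mat (Fin n)} {t : ℝ}
    (hf : HasEntryDerivAt f f' t) (c : ℂ) : HasEntryDerivAt (fun s => c • f s) (c • f') t :=
  fun i j => (hf i j).const_mul c

lemma HasEntryDerivAt.real_smul {r : ℝ → ℝ} {r' : ℝ} {f : ℝ → Mat (Fin n)}
    {f' : Mat (Fin n)} {t : ℝ} (hr : HasDerivAt r r' t) (hf : HasEntryDerivAt f f' t) :
    HasEntryDerivAt (fun s => r s • f s) (r t • f' + r' • f t) t :=
  fun i j => hr.smul (hf i j)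

lemma HasEntryDerivAt.conjTranspose {f : ℝ → Mat (Fin n)} {f' : Mat (Fin n)} {t : ℝ}
    (hf : HasEntryDerivAt f f' t) : HasEntryDerivAt (fun s => (f s)ᴴ) f'ᴴ t :=
  fun i j => (hf j i).star

lemma HasEntryDerivAt.mul {f g : ℝ → Mat (Fin n)} {f' g' : Mat (Fin n)} {t : ℝ}
    (hf : HasEntryDerivAt f f' t) (hg : HasEntryDerivAt g g' t) :
    HasEntryDerivAt (fun s => f s * g s) (f' * g t + f t * g') t := by
  intro i j
  simp only [Matrix.mul_apply, Matrix.add_apply, ← Finset.sum_add_distrib]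
  exact HasDerivAt.fun_sum fun k _ => (hf i k).mul (hg k j)

lemma HasEntryDerivAt.linear_functional {f : ℝ → Mat (Fin n)} {f' : Mat (Fin n)} {t : ℝ}
    (hf : HasEntryDerivAt f f' t) (φ : Mat (Fin n) →ₗ[ℂ] ℂ) :
    HasDerivAt (fun s => φ (f s)) (φ f') t := by
  rw [show (fun s => φ (f s)) = _ from funext fun s => linearMap_apply_eq_sum φ (f s),
    linearMap_apply_eq_sum φ f']
  exact HasDerivAt.fun_sum fun i _ => HasDerivAt.fun_sum fun j _ => (hf i j).mul_const _

lemma HasEntryDerivAt.linear {f : ℝ → Mat (Fin n)} {f' : Mat (Fin n)} {t : ℝ}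
    (hf : HasEntryDerivAt f f' t) (L : Mat (Fin n) →ₗ[ℂ] Mat (Fin n)) :
    HasEntryDerivAt (fun s => L (f s)) (L f') t :=
  fun i j => hf.linear_functional (Matrix.entryLinearMap ℂ ℂ i j ∘ₗ L)

lemma HasEntryDerivAt.scomp {f : ℝ → Mat (Fin n)} {f' : Mat (Fin n)} {r : ℝ → ℝ} {r' t : ℝ}
    (hf : HasEntryDerivAt f f' (r t)) (hr : HasDerivAt r r' t) :
    HasEntryDerivAt (fun s => f (r s)) (r' • f') t :=
  fun i j => HasDerivAt.scomp t (hf i j) hr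

lemma HasEntryDerivAt.unique {f : ℝ → Mat (Fin n)} {f' g' : Mat (Fin n)} {t : ℝ}
    (hf : HasEntryDerivAt f f' t) (hg : HasEntryDerivAt f g' t) : f' = g' := by
  ext i j
  exact (hf i j).unique (hg i j)

lemma HasEntryDerivAt.gamma {L : Mat (Fin n) →ₗ[ℂ] Mat (Fin n)} {b : ℝ → Mat (Fin n)}
    {b' : Mat (Fin n)} {t : ℝ} (hb : HasEntryDerivAt b b' t) :
    HasEntryDerivAt (fun s => Gamma L (b s) (b s))
      (Gamma L b' (b t) + Gamma L (b t) b') t := by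
  have h := (((hb.conjTranspose.mul (hb.linear L)).add
    ((hb.linear L).conjTranspose.mul hb)).sub
      ((hb.conjTranspose.mul hb).linear L)).const_smul (2:ℂ)⁻¹
  refine h.congr_deriv ?_
  simp only [Gamma, ← smul_add, map_add]
  congr 1
  abel

end EntrywiseCalculus

section Positivity

variable {m : Type*} [Fintype m]

/-- The quadratic form of a matrix, as a linear functional of the matrix. -/
def quadForm (x : m → ℂ) : Mat m →ₗ[ℂ] ℂ where
  toFun M := star x ⬝ᵥ (M *ᵥ x)
  map_add' A B := by rw [Matrix.add_mulVec, dotProduct_add]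
  map_smul' c A := by rw [Matrix.smul_mulVec, dotProduct_smul]; rfl

lemma posSemidef_iff_quadForm [DecidableEq m] {M : Mat m} :
    M.PosSemidef ↔ ∀ x, 0 ≤ quadForm x M := by
  refine ⟨fun h x => h.dotProduct_mulVec_nonneg x, fun h => ?_⟩
  refine Matrix.PosSemidef.of_dotProduct_mulVec_nonneg ?_ h
  rw [← Matrix.isSymmetric_toEuclideanLin_iff, LinearMap.isSymmetric_iff_inner_map_self_real]
  intro v
  have hv := h v.ofLp
  have e : inner ℂ v (toEuclideanLin M v) = quadForm v.ofLp M := by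
    simp [EuclideanSpace.inner_eq_star_dotProduct, quadForm, dotProduct_comm]
  rw [inner_conj_symm, e, ← inner_conj_symm, e]
  exact (Complex.conj_eq_iff_im.mpr (Complex.nonneg_iff.mp hv).2.symm).symm

lemma le_of_hasDerivAt_nonneg {f f' : ℝ → ℝ} {t : ℝ} (ht : 0 ≤ t)
    (hf : ∀ s ∈ Set.Icc 0 t, HasDerivAt f (f' s) s) (h0 : ∀ s ∈ Set.Icc 0 t, 0 ≤ f' s) :
    f 0 ≤ f t := by
  refine monotoneOn_of_deriv_nonneg (convex_Icc 0 t)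
    (fun s hs => (hf s hs).continuousAt.continuousWithinAt)
    (fun s hs => (hf s (interior_subset hs)).differentiableAt.differentiableWithinAt)
    (fun s hs => ?_) (Set.left_mem_Icc.2 ht) (Set.right_mem_Icc.2 ht) ht
  rw [(hf s (interior_subset hs)).deriv]
  exact h0 s (interior_subset hs)

lemma complex_sub_nonneg_of_hasDerivAt {f f' : ℝ → ℂ} {t : ℝ} (ht : 0 ≤ t)
    (hf : ∀ s ∈ Set.Icc 0 t, HasDerivAt f (f' s) s) (h0 : ∀ s ∈ Set.Icc 0 t, 0 ≤ f' s) :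
    0 ≤ f t - f 0 := by
  have hre : ∀ s ∈ Set.Icc 0 t, HasDerivAt (fun s => (f s).re) (f' s).re s := fun s hs =>
    Complex.reCLM.hasFDerivAt.comp_hasDerivAt s (hf s hs)
  have him : ∀ s ∈ Set.Icc 0 t, HasDerivAt (fun s => (f s).im) (f' s).im s := fun s hs =>
    Complex.imCLM.hasFDerivAt.comp_hasDerivAt s (hf s hs)
  have h0' := fun s hs => Complex.nonneg_iff.mp (h0 s hs)
  have h1 := le_of_hasDerivAt_nonneg ht hre fun s hs => (h0' s hs).1
  have h2 := le_of_hasDerivAt_nonneg ht him fun s hs => (h0' s hs).2.le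
  have h3 := le_of_hasDerivAt_nonneg ht (fun s hs => (him s hs).neg)
    fun s hs => by rw [← (h0' s hs).2, neg_zero]
  simp only [Pi.neg_apply] at h3
  refine Complex.nonneg_iff.mpr ⟨?_, ?_⟩
  · rw [Complex.sub_re]; linarith
  · rw [Complex.sub_im]; linarith

lemma posSemidef_sub_of_hasEntryDerivAt {n : ℕ} {F F' : ℝ → Mat (Fin n)} {t : ℝ} (ht : 0 ≤ t)
    (hF : ∀ s ∈ Set.Icc 0 t, HasEntryDerivAt F (F' s) s)
    (h0 : ∀ s ∈ Set.Icc 0 t, (F' s).PosSemidef) : (F t - F 0).PosSemidef := by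
  rw [posSemidef_iff_quadForm]
  intro x
  rw [map_sub]
  exact complex_sub_nonneg_of_hasDerivAt ht (fun s hs => (hF s hs).linear_functional _)
    fun s hs => posSemidef_iff_quadForm.mp (h0 s hs) x

lemma posSemidef_deriv_of_posSemidef {n : ℕ} {G : ℝ → Mat (Fin n)} {G' : Mat (Fin n)}
    (hG : HasEntryDerivAt G G' 0) (h0 : G 0 = 0) (h : ∀ t, 0 ≤ t → (G t).PosSemidef) :
    G'.PosSemidef := by
  rw [posSemidef_iff_quadForm]
  intro x
  refine ge_of_tendsto (hG.linear_functional (quadForm x)).tendsto_slope_zero_right ?_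
  filter_upwards [self_mem_nhdsWithin] with t ht
  have ht' : (0:ℝ) < t := ht
  have := posSemidef_iff_quadForm.mp (h t ht'.le) x
  simp only [zero_add, h0, map_zero, sub_zero]
  exact smul_nonneg (inv_nonneg.mpr ht'.le) this

lemma IsCP.posSemidef {Φ : Mat m →ₗ[ℂ] Mat m} (hΦ : IsCP Φ) {A : Mat m}
    (hA : A.PosSemidef) : (Φ A).PosSemidef := by
  have h := hΦ 1 (fun _ _ => A) (hA.submatrix Prod.snd)
  exact h.submatrix fun i => ((0 : Fin 1), i)

/-- The Kadison–Schwarz inequality for unital completely positive maps. -/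
lemma IsCP.kadison_schwarz [DecidableEq m] {Φ : Mat m →ₗ[ℂ] Mat m} (hΦ : IsCP Φ)
    (h1 : Φ 1 = 1) (x : Mat m) : (Φ (xᴴ * x) - (Φ x)ᴴ * Φ x).PosSemidef := by
  let v : Fin 2 → Mat m := ![1, x]
  let V : Matrix m (Fin 2 × m) ℂ := Matrix.of fun i p => v p.1 i p.2
  have hB : (blockify fun j k => (v j)ᴴ * v k) = Vᴴ * V := by
    ext p q
    simp [blockify, V, Matrix.mul_apply]
  have h := hΦ 2 (fun j k => (v j)ᴴ * v k) (hB ▸ Matrix.posSemidef_conjTranspose_mul_self V)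
  have hstar : Φ xᴴ = (Φ x)ᴴ := by
    ext i j
    have := h.isHermitian.apply (1, i) (0, j)
    simpa [blockify, v] using this.symm
  let w : Fin 2 → Mat m := ![-Φ x, 1]
  let W : Matrix (Fin 2 × m) m ℂ := Matrix.of fun p i => w p.1 p.2 i
  have hW : Wᴴ * (blockify fun j k => Φ ((v j)ᴴ * v k)) * W
      = ∑ k, (∑ j, (w j)ᴴ * Φ ((v j)ᴴ * v k)) * w k := by
    ext a b
    simp only [W, blockify, Matrix.mul_apply, Matrix.sum_apply, Fintype.sum_prod_type,
      Matrix.conjTranspose_apply, Matrix.of_apply]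
  have := h.conjTranspose_mul_mul_same W
  rw [hW] at this
  convert this using 1
  simp [Fin.sum_univ_two, v, w, h1, hstar, sub_eq_neg_add]

end Positivity

namespace QMS

variable {n : ℕ} (Q : QMS (Fin n))

lemma hasEntryDerivAt_zero (x : Mat (Fin n)) :
    HasEntryDerivAt (fun t => Q.P t x) (-(Q.gen x)) 0 :=
  fun i j => Q.P_deriv x i j

lemma hasEntryDerivAt (x : Mat (Fin n)) (t : ℝ) :
    HasEntryDerivAt (fun s => Q.P s x) (-(Q.gen (Q.P t x))) t := by
  have h0 := Q.hasEntryDerivAt_zero (Q.P t x)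
  have h : HasDerivAt (fun s : ℝ => s - t) 1 t := (hasDerivAt_id t).sub_const t
  rw [← sub_self t] at h0
  have h2 := HasEntryDerivAt.scomp (r := fun s => s - t) h0 h
  rw [one_smul] at h2
  have e : (fun s => Q.P (s - t) (Q.P t x)) = fun s => Q.P s x := by
    funext s
    rw [← LinearMap.comp_apply, ← Q.P_add, sub_add_cancel]
  rwa [e] at h2

lemma gen_comm (t : ℝ) (x : Mat (Fin n)) : Q.gen (Q.P t x) = Q.P t (Q.gen x) := by
  have h1 := Q.hasEntryDerivAt_zero (Q.P t x)
  have h2 := (Q.hasEntryDerivAt_zero x).linear (Q.P t)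
  have e : (fun s => Q.P t (Q.P s x)) = fun s => Q.P s (Q.P t x) := by
    funext s
    rw [← LinearMap.comp_apply, ← Q.P_add, add_comm, Q.P_add, LinearMap.comp_apply]
  rw [e] at h2
  simpa using h1.unique h2

lemma hasEntryDerivAt_apply {y : ℝ → Mat (Fin n)} {y' : Mat (Fin n)} {t : ℝ}
    (hy : HasEntryDerivAt y y' t) :
    HasEntryDerivAt (fun s => Q.P s (y s)) (Q.P t (y' - Q.gen (y t))) t := by
  have e : ∀ (Φ : Mat (Fin n) →ₗ[ℂ] Mat (Fin n)) X k l,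
      Φ X k l = ∑ i, ∑ j, X i j * Φ (single i j 1) k l := fun Φ X k l => by
    rw [linearMap_apply_eq_sum Φ X]
    simp only [Matrix.sum_apply, Matrix.smul_apply, smul_eq_mul]
  intro k l
  have h : HasDerivAt (fun s => ∑ i, ∑ j, y s i j * Q.P s (single i j 1) k l)
      (∑ i, ∑ j, (y' i j * Q.P t (single i j 1) k l
        + y t i j * (-(Q.gen (Q.P t (single i j 1)))) k l)) t :=
    HasDerivAt.fun_sum fun i _ => HasDerivAt.fun_sum fun j _ =>
      (hy i j).mul (Q.hasEntryDerivAt (single i j 1) t k l)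
  simp only [← e] at h
  convert h using 1
  have e2 := e (Q.gen ∘ₗ Q.P t) (y t) k l
  simp only [LinearMap.comp_apply] at e2
  simp only [Finset.sum_add_distrib, ← e, Matrix.neg_apply, mul_neg, Finset.sum_neg_distrib,
    ← e2, map_sub, Matrix.sub_apply, ← Q.gen_comm]
  exact sub_eq_add_neg _ _

end QMS

lemma hasDerivAt_exp_rate (K s : ℝ) : HasDerivAt (fun s => Real.exp (-(2 * K * s)))
    (-(2 * K) * Real.exp (-(2 * K * s))) s := by
  have h : HasDerivAt (fun s : ℝ => -(2 * K * s)) (-(2 * K)) s := by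
    have := ((hasDerivAt_id s).const_mul (2 * K)).fun_neg
    rwa [mul_one] at this
  rw [mul_comm (-(2 * K))]
  exact h.exp

lemma hasDerivAt_cK (K s : ℝ) :
    HasDerivAt (cK K) (2 * Real.exp (-(2 * K * s))) s := by
  by_cases hK : K = 0
  · have e : cK K = fun t => 2 * t := by funext t; simp [cK, hK]
    rw [e]
    simpa [hK] using (hasDerivAt_id s).const_mul 2
  · have e : cK K = fun t => (1 - Real.exp (-(2 * K * t))) / K := by funext t; simp [cK, hK]
    rw [e]
    have h := ((hasDerivAt_exp_rate K s).const_sub 1).div_const K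
    have e' : -(-(2 * K) * Real.exp (-(2 * K * s))) / K = 2 * Real.exp (-(2 * K * s)) := by
      rw [div_eq_iff hK]
      ring
    rwa [e'] at h

lemma cK_zero (K : ℝ) : cK K 0 = 0 := by simp [cK]

/-- Equivalence of the semigroup form and the `Γ₂` form of the
Bakry–Émery curvature-dimension condition `BE(K,N)` for a quantum Markov semigroup
on `Mₙ(ℂ)`, with `K ∈ ℝ` and `N ∈ (0,∞]`. -/
theorem BE_iff_gamma2 {n : ℕ} (Q : QMS (Fin n)) (K : ℝ) (N : ℝ≥0∞) (hN : 0 < N) :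
    (∀ t : ℝ, 0 ≤ t → ∀ a : Mat (Fin n),
      matLE (Gamma Q.gen (Q.P t a) (Q.P t a))
        (Real.exp (-(2 * K * t)) • Q.P t (Gamma Q.gen a a) -
          (N⁻¹.toReal * cK K t) • ((Q.gen (Q.P t a))ᴴ * (Q.gen (Q.P t a))))) ↔
    BE Q.gen K N⁻¹.toReal := by
  have hν : 0 ≤ N⁻¹.toReal := ENNReal.toReal_nonneg
  generalize N⁻¹.toReal = ν at hν ⊢
  have gamma_neg : ∀ x y, Gamma Q.gen (-x) y = -Gamma Q.gen x y := fun x y => by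
    simp only [Gamma, map_neg, Matrix.conjTranspose_neg, Matrix.neg_mul, ← smul_neg]
    congr 1; abel
  have gamma_neg' : ∀ x y, Gamma Q.gen x (-y) = -Gamma Q.gen x y := fun x y => by
    simp only [Gamma, map_neg, Matrix.mul_neg, ← smul_neg]
    congr 1; abel
  have gamma2_two : ∀ a, Gamma Q.gen (Q.gen a) a + Gamma Q.gen a (Q.gen a)
      - Q.gen (Gamma Q.gen a a) = (2:ℝ) • Gamma2 Q.gen a a := fun a => by
    rw [Gamma2, ← Complex.coe_smul, smul_smul]
    norm_num
    abel
  constructor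
  · intro h a
    have hP := Q.hasEntryDerivAt a 0
    have hc : HasDerivAt (fun t => ν * cK K t) (ν * (2 * Real.exp (-(2 * K * 0)))) 0 :=
      (hasDerivAt_cK K 0).const_mul ν
    have hL := hP.linear Q.gen
    have hD := (((HasEntryDerivAt.real_smul (hasDerivAt_exp_rate K 0)
      (Q.hasEntryDerivAt (Gamma Q.gen a a) 0)).sub
        (HasEntryDerivAt.real_smul hc (hL.conjTranspose.mul hL))).sub
          (hP.gamma (L := Q.gen)))
    have key := posSemidef_deriv_of_posSemidef hD
      (by simp [cK_zero, Q.P_zero]) (fun t ht => h t ht a)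
    have key2 := key.smul (show (0:ℝ) ≤ 2⁻¹ by norm_num)
    unfold matLE
    convert key2 using 1
    simp only [Q.P_zero, LinearMap.id_apply, cK_zero, gamma_neg, gamma_neg', mul_zero, neg_zero,
      Real.exp_zero, zero_smul, one_smul, mul_one, zero_add]
    have g := gamma2_two a
    have g' : Gamma2 Q.gen a a = (2:ℝ)⁻¹ • (Gamma Q.gen (Q.gen a) a + Gamma Q.gen a (Q.gen a)
      - Q.gen (Gamma Q.gen a a)) := by rw [g, smul_smul]; norm_num
    rw [g']
    module
  · intro h t ht a
    set M := (Q.gen (Q.P t a))ᴴ * Q.gen (Q.P t a) with hM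
    have hb : ∀ s, HasEntryDerivAt (fun s => Q.P (t - s) a) (Q.gen (Q.P (t - s) a)) s := by
      intro s
      have hr : HasDerivAt (fun s : ℝ => t - s) (-1) s := by
        simpa using (hasDerivAt_id s).const_sub t
      simpa using (Q.hasEntryDerivAt a (t - s)).scomp hr
    have hF := fun s => (HasEntryDerivAt.real_smul (hasDerivAt_exp_rate K s)
      (Q.hasEntryDerivAt_apply ((hb s).gamma (L := Q.gen)))).sub
        (HasEntryDerivAt.real_smul ((hasDerivAt_cK K s).const_mul ν) (HasEntryDerivAt.const M s))
    have key := posSemidef_sub_of_hasEntryDerivAt ht (fun s _ => hF s) ?_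
    · unfold matLE
      simpa [cK_zero, Q.P_zero] using key
    · intro s hs
      rw [gamma2_two]
      have hPM : Q.P s (Q.gen (Q.P (t - s) a)) = Q.gen (Q.P t a) := by
        rw [← Q.gen_comm, ← LinearMap.comp_apply (Q.P s), ← Q.P_add, add_sub_cancel]
      set b := Q.P (t - s) a
      have h1 := (Q.P_cp s hs.1).posSemidef (h b)
      have h2 := ((Q.P_cp s hs.1).kadison_schwarz (Q.P_unital s hs.1) (Q.gen b)).smul hν
      rw [hPM, ← hM] at h2
      have h3 := (h1.add h2).smul
        (show (0:ℝ) ≤ 2 * Real.exp (-(2 * K * s)) by positivity)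
      convert h3 using 1
      have sm : ∀ (r : ℝ) X, Q.P s (r • X) = r • Q.P s X := fun r X => by
        rw [← Complex.coe_smul, _root_.map_smul, Complex.coe_smul]
      simp only [map_sub, map_add, sm]
      module

end CD
end

section
/- Let (P_t) be a tracially symmetric quantum Markov semigroup on M_n(ℂ) whose generator has the Lindblad form L = ∑_{j=1}^d ∂_j†∂_j. If (P_t) satisfies the K-intertwining condition for some K ∈ ℝ, then (P_t) satisfies BE(K,d), i.e. Γ₂(a) ≥ K·Γ(a) + (1/d)·|L a|² for all a ∈ M_n(ℂ). -/
open Matrix Filter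
open scoped ComplexOrder ENNReal Kronecker

namespace CD

section Derivation

variable {ι : Type*} [Fintype ι]

lemma comm_mul (v x y : Mat ι) : comm v (x * y) = comm v x * y + x * comm v y := by
  simp only [comm, sub_mul, mul_sub, Matrix.mul_assoc]
  abel

lemma comm_add (v x y : Mat ι) : comm v (x + y) = comm v x + comm v y := by
  simp only [comm, mul_add, add_mul]
  abel

lemma conjTranspose_comm (v x : Mat ι) : (comm v x)ᴴ = -comm vᴴ xᴴ := by
  simp [comm]

/-- Positive semidefinite quadratic Cauchy–Schwarz inequality for a finite family of matrices. -/
lemma posSemidef_sum_sub_inv_smul {α : Type*} (W : Finset α) (y : α → Mat ι) (d : ℕ)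
    (hd : W.card ≤ d) :
    (∑ w ∈ W, (y w)ᴴ * y w -
      ((d : ℝ)⁻¹) • ((∑ w ∈ W, y w)ᴴ * ∑ w ∈ W, y w)).PosSemidef := by
  rcases Nat.eq_zero_or_pos d with rfl | hpos
  · have hW : W = ∅ := Finset.card_eq_zero.mp (Nat.le_zero.mp hd)
    simp [hW, Matrix.PosSemidef.zero]
  set S := ∑ w ∈ W, y w with hS
  have hd0 : (d : ℝ) ≠ 0 := by positivity
  have key : ∑ w ∈ W, (y w)ᴴ * y w - ((d : ℝ)⁻¹) • (Sᴴ * S) =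
      ∑ w ∈ W, (y w - (d : ℝ)⁻¹ • S)ᴴ * (y w - (d : ℝ)⁻¹ • S) +
        (((d : ℝ) - W.card) * ((d : ℝ)⁻¹ * (d : ℝ)⁻¹)) • (Sᴴ * S) := by
    have h1 : ∀ w, (y w - (d : ℝ)⁻¹ • S)ᴴ * (y w - (d : ℝ)⁻¹ • S) =
        (y w)ᴴ * y w - (d : ℝ)⁻¹ • ((y w)ᴴ * S) - (d : ℝ)⁻¹ • (Sᴴ * y w) +
          ((d : ℝ)⁻¹ * (d : ℝ)⁻¹) • (Sᴴ * S) := by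
      intro w
      simp only [conjTranspose_sub, conjTranspose_smul, star_trivial, sub_mul, mul_sub,
        smul_mul_assoc, mul_smul_comm, smul_sub, smul_smul]
      abel
    simp only [h1, Finset.sum_add_distrib, Finset.sum_sub_distrib, Finset.sum_const,
      ← Nat.cast_smul_eq_nsmul ℝ]
    simp only [← Finset.smul_sum, ← Finset.sum_mul, ← Finset.mul_sum, ← conjTranspose_sum, ← hS]
    have h2 : ((d : ℝ) - W.card) * ((d : ℝ)⁻¹ * (d : ℝ)⁻¹) =
        (d : ℝ)⁻¹ - W.card * ((d : ℝ)⁻¹ * (d : ℝ)⁻¹) := by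
      field_simp
    rw [h2]
    module
  rw [key]
  refine .add (Matrix.posSemidef_sum _ fun w _ => Matrix.posSemidef_conjTranspose_mul_self _) ?_
  refine .smul (Matrix.posSemidef_conjTranspose_mul_self _) ?_
  have : (W.card : ℝ) ≤ d := by exact_mod_cast hd
  have := sub_nonneg.mpr this
  positivity

end Derivation

lemma sum_conjTranspose_of_closed {ι M : Type*} [AddCommMonoid M] {W : Finset (Mat ι)}
    (hW : ∀ w ∈ W, wᴴ ∈ W) (f : Mat ι → M) : ∑ w ∈ W, f wᴴ = ∑ w ∈ W, f w :=
  Finset.sum_bij' (fun w _ => wᴴ) (fun w _ => wᴴ) hW hW (by simp) (by simp) (by simp)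

section WeightedLindblad

variable {ι : Type*} [Fintype ι] {L : Mat ι →ₗ[ℂ] Mat ι} {W : Finset (Mat ι)} {c : Mat ι → ℝ}

lemma Gamma_eq_sum (hW : ∀ w ∈ W, wᴴ ∈ W) (hc : ∀ w, c wᴴ = c w)
    (hL : ∀ x, L x = ∑ w ∈ W, c w • comm wᴴ (comm w x)) (hstar : ∀ x, (L x)ᴴ = L xᴴ)
    (a b : Mat ι) :
    Gamma L a b = ∑ w ∈ W, c w • ((comm w a)ᴴ * comm w b) := by
  have h1 : ∀ w, comm wᴴ (comm w (aᴴ * b)) =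
      aᴴ * comm wᴴ (comm w b) + comm wᴴ (comm w aᴴ) * b
        - ((comm wᴴ a)ᴴ * comm wᴴ b + (comm w a)ᴴ * comm w b) := by
    intro w
    simp only [comm_mul, comm_add, conjTranspose_comm, conjTranspose_conjTranspose]
    simp only [neg_mul]
    abel
  have h2 : ∑ w ∈ W, c w • ((comm wᴴ a)ᴴ * comm wᴴ b) =
      ∑ w ∈ W, c w • ((comm w a)ᴴ * comm w b) := by
    rw [← sum_conjTranspose_of_closed hW (fun w => c w • ((comm w a)ᴴ * comm w b))]
    simp only [hc]
  have h3 : aᴴ * L b + (L a)ᴴ * b - L (aᴴ * b) =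
      (2 : ℂ) • ∑ w ∈ W, c w • ((comm w a)ᴴ * comm w b) := by
    rw [hstar, hL, hL, hL]
    simp only [h1, smul_sub, smul_add, Finset.sum_sub_distrib, Finset.sum_add_distrib, h2,
      Finset.mul_sum, Finset.sum_mul, mul_smul_comm, smul_mul_assoc]
    rw [two_smul]
    abel
  rw [Gamma, h3, smul_smul]
  norm_num

lemma Gamma2_eq_sum (hW : ∀ w ∈ W, wᴴ ∈ W) (hc : ∀ w, c wᴴ = c w)
    (hL : ∀ x, L x = ∑ w ∈ W, c w • comm wᴴ (comm w x)) (hstar : ∀ x, (L x)ᴴ = L xᴴ) {K : ℝ}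
    (hK : ∀ w ∈ W, ∀ x, comm w (L x) = L (comm w x) + K • comm w x) (a : Mat ι) :
    Gamma2 L a a = K • Gamma L a a + ∑ w ∈ W, c w • Gamma L (comm w a) (comm w a) := by
  have h := Gamma_eq_sum hW hc hL hstar
  have h1 : Gamma L a (L a) + Gamma L (L a) a - L (Gamma L a a) =
      (2 : ℂ) • (K • Gamma L a a + ∑ w ∈ W, c w • Gamma L (comm w a) (comm w a)) := by
    rw [h, h, h, map_sum, Finset.smul_sum, ← Finset.sum_add_distrib, ← Finset.sum_add_distrib,
      ← Finset.sum_sub_distrib, Finset.smul_sum]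
    refine Finset.sum_congr rfl fun w hw => ?_
    rw [LinearMap.map_smul_of_tower, hK w hw, Gamma]
    simp only [conjTranspose_add, conjTranspose_smul, star_trivial, mul_add, add_mul,
      mul_smul_comm, smul_mul_assoc]
    module
  rw [Gamma2, h1, smul_smul]
  norm_num

lemma BE_of_weighted_lindblad (hW : ∀ w ∈ W, wᴴ ∈ W) (hc : ∀ w, c wᴴ = c w)
    (hc0 : ∀ w, 0 ≤ c w)
    (hL : ∀ x, L x = ∑ w ∈ W, c w • comm wᴴ (comm w x)) (hstar : ∀ x, (L x)ᴴ = L xᴴ) {K : ℝ}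
    (hK : ∀ w ∈ W, ∀ x, comm w (L x) = L (comm w x) + K • comm w x) {d : ℕ} (hd : W.card ≤ d)
    [DecidableEq ι] :
    BE L K (d : ℝ)⁻¹ := by
  intro a
  have hsplit : ∀ w ∈ W, c w • Gamma L (comm w a) (comm w a) =
      (c w • comm wᴴ (comm w a))ᴴ * (c w • comm wᴴ (comm w a)) +
      c w • ∑ u ∈ W.erase wᴴ, c u • ((comm u (comm w a))ᴴ * comm u (comm w a)) := by
    intro w hw
    rw [Gamma_eq_sum hW hc hL hstar, ← Finset.add_sum_erase W _ (hW w hw), hc, smul_add]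
    simp only [conjTranspose_smul, star_trivial, mul_smul_comm, smul_mul_assoc]
  rw [matLE, Gamma2_eq_sum hW hc hL hstar hK, add_sub_add_left_eq_sub,
    Finset.sum_congr rfl hsplit, Finset.sum_add_distrib, add_sub_right_comm, hL a]
  refine .add (posSemidef_sum_sub_inv_smul W _ d hd) ?_
  refine Matrix.posSemidef_sum _ fun w _ => .smul (Matrix.posSemidef_sum _ fun u _ => ?_) (hc0 w)
  exact .smul (Matrix.posSemidef_conjTranspose_mul_self _) (hc0 u)

end WeightedLindblad

section Semigroup

variable {ι : Type*} [Fintype ι] [DecidableEq ι]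

/-- Completely positive maps are `*`-preserving, by positivity of the image of the Gram block
matrix of `1` and `x`. -/
lemma IsCP.map_conjTranspose {Φ : Mat ι →ₗ[ℂ] Mat ι} (hΦ : IsCP Φ) (x : Mat ι) :
    (Φ x)ᴴ = Φ xᴴ := by
  let y : Fin 2 → Mat ι := ![1, x]
  have hpos : (blockify fun j k => (y j)ᴴ * y k).PosSemidef := by
    let Y : Matrix ι (Fin 2 × ι) ℂ := Matrix.of fun i p => y p.1 i p.2
    have h : (blockify fun j k => (y j)ᴴ * y k) = Yᴴ * Y := by
      ext p q
      simp [blockify, Y, Matrix.mul_apply]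
    rw [h]
    exact Matrix.posSemidef_conjTranspose_mul_self _
  have hherm := (hΦ 2 _ hpos).isHermitian
  ext i j
  have := hherm.apply (1, i) (0, j)
  simpa [blockify, y] using this

lemma QMS.hasDerivWithinAt (Q : QMS ι) (x : Mat ι) (i j : ι) :
    HasDerivWithinAt (fun t : ℝ => Q.P t x i j) (-(Q.gen x i j)) (Set.Ici 0) 0 :=
  (Q.P_deriv x i j).hasDerivWithinAt

lemma eq_of_hasDerivWithinAt_Ici {f g : ℝ → ℂ} {f' g' : ℂ}
    (hf : HasDerivWithinAt f f' (Set.Ici 0) 0) (hg : HasDerivWithinAt g g' (Set.Ici 0) 0)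
    (hfg : ∀ t, 0 ≤ t → f t = g t) : f' = g' :=
  (uniqueDiffWithinAt_Ici (0 : ℝ)).eq_deriv _ hf
    (hg.congr (fun t ht => hfg t ht) (hfg 0 le_rfl))

lemma QMS.gen_conjTranspose (Q : QMS ι) (x : Mat ι) : (Q.gen x)ᴴ = Q.gen xᴴ := by
  ext i j
  have h1 := (Q.hasDerivWithinAt x j i).star
  have h2 := Q.hasDerivWithinAt xᴴ i j
  have := eq_of_hasDerivWithinAt_Ici h1 h2 fun t ht => by
    rw [← (Q.P_cp t ht).map_conjTranspose x, conjTranspose_apply]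
  simpa using this

lemma QMS.comm_gen (Q : QMS ι) {d : ℕ} {v : Fin d → Mat ι} {K : ℝ} (h : Intertwining Q v K)
    (j : Fin d) (x : Mat ι) :
    comm (v j) (Q.gen x) = Q.gen (comm (v j) x) + K • comm (v j) x := by
  ext i k
  have h1 : HasDerivWithinAt (fun t : ℝ => comm (v j) (Q.P t x) i k)
      (∑ l, v j i l * -(Q.gen x l k) - ∑ l, -(Q.gen x i l) * v j l k) (Set.Ici 0) 0 := by
    simp only [comm, Matrix.sub_apply, Matrix.mul_apply]
    exact (HasDerivWithinAt.fun_sum fun l _ => (Q.hasDerivWithinAt x l k).const_mul _).sub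
      (HasDerivWithinAt.fun_sum fun l _ => (Q.hasDerivWithinAt x i l).mul_const _)
  have hexp : HasDerivWithinAt (fun t : ℝ => Real.exp (-(K * t))) (-K) (Set.Ici 0) 0 := by
    have := (((hasDerivAt_id (0 : ℝ)).const_mul K).neg.exp).hasDerivWithinAt (s := Set.Ici 0)
    simpa using this
  have h2 := hexp.smul (Q.hasDerivWithinAt (comm (v j) x) i k)
  have h3 := eq_of_hasDerivWithinAt_Ici h1 h2 fun t ht => by
    rw [h t ht j x]; rfl
  simp only [comm, Q.P_zero, LinearMap.id_apply, mul_zero, neg_zero, Real.exp_zero,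
    one_smul, neg_mul, mul_neg, Finset.sum_neg_distrib, Matrix.sub_apply, Matrix.mul_apply,
    Matrix.add_apply, Matrix.smul_apply, neg_smul] at h3 ⊢
  linear_combination -h3

end Semigroup

/-- The multiplicity of the operator `w` in the family `v`, averaged with that of `wᴴ`. -/
noncomputable def symMultiplicity {ι : Type*} [DecidableEq (Mat ι)] {d : ℕ} (v : Fin d → Mat ι)
    (w : Mat ι) : ℝ :=
  2⁻¹ * (((Finset.univ.filter fun j => v j = w).card : ℝ) +
    (Finset.univ.filter fun j => v j = wᴴ).card)

lemma sum_eq_sum_symMultiplicity {ι : Type*} [Fintype ι] [DecidableEq (Mat ι)]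
    {L : Mat ι →ₗ[ℂ] Mat ι} {d : ℕ} {v : Fin d → Mat ι}
    (hL : ∀ x, L x = ∑ j, comm ((v j)ᴴ) (comm (v j) x)) (hstar : ∀ x, (L x)ᴴ = L xᴴ)
    (hW : ∀ w ∈ Finset.univ.image v, wᴴ ∈ Finset.univ.image v) (x : Mat ι) :
    L x = ∑ w ∈ Finset.univ.image v, symMultiplicity v w • comm wᴴ (comm w x) := by
  have h1 : L x = ∑ w ∈ Finset.univ.image v,
      ((Finset.univ.filter fun j => v j = w).card : ℝ) • comm wᴴ (comm w x) := by
    rw [hL, Finset.sum_comp (fun w => comm wᴴ (comm w x)) v]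
    simp only [Nat.cast_smul_eq_nsmul]
  have h2 : L x = ∑ w ∈ Finset.univ.image v,
      ((Finset.univ.filter fun j => v j = wᴴ).card : ℝ) • comm wᴴ (comm w x) := by
    have h3 : L x = ∑ j, comm (v j) (comm (v j)ᴴ x) := by
      have := hstar xᴴ
      rw [conjTranspose_conjTranspose] at this
      rw [← this, hL, conjTranspose_sum]
      refine Finset.sum_congr rfl fun j _ => ?_
      simp only [comm, conjTranspose_sub, conjTranspose_mul, conjTranspose_conjTranspose]
      simp only [mul_sub, sub_mul, Matrix.mul_assoc]
      abel
    rw [← sum_conjTranspose_of_closed hW, h3, Finset.sum_comp (fun w => comm w (comm wᴴ x)) v]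
    simp only [Nat.cast_smul_eq_nsmul, conjTranspose_conjTranspose]
  simp only [symMultiplicity, mul_smul, add_smul, ← Finset.smul_sum, Finset.sum_add_distrib,
    ← h1, ← h2]
  module

/-- A tracially symmetric quantum Markov semigroup on `Mₙ(ℂ)` whose
generator has Lindblad form with `d` partial derivatives and which satisfies the
`K`-intertwining condition satisfies the Bakry–Émery condition `BE(K,d)`. -/
theorem BE_of_intertwining {n d : ℕ} (Q : QMS (Fin n)) (hsymm : TraciallySymm Q)
    (v : Fin d → Mat (Fin n)) (hLind : LindbladForm Q.gen v) (K : ℝ)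
    (hint : Intertwining Q v K) :
    BE Q.gen K (d : ℝ)⁻¹ := by
  classical
  obtain ⟨hv, hL⟩ := hLind
  have hW : ∀ w ∈ Finset.univ.image v, wᴴ ∈ Finset.univ.image v := by
    intro w hw
    obtain ⟨j, -, rfl⟩ := Finset.mem_image.mp hw
    obtain ⟨k, hk⟩ := hv j
    exact Finset.mem_image.mpr ⟨k, Finset.mem_univ k, hk.symm⟩
  refine BE_of_weighted_lindblad (W := Finset.univ.image v) (c := symMultiplicity v) hW
    (fun w => ?_) (fun w => ?_)
    (sum_eq_sum_symMultiplicity hL Q.gen_conjTranspose hW) Q.gen_conjTranspose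
    (fun w hw x => ?_) ?_
  · simp only [symMultiplicity, conjTranspose_conjTranspose, add_comm]
  · unfold symMultiplicity
    positivity
  · obtain ⟨j, -, rfl⟩ := Finset.mem_image.mp hw
    exact Q.comm_gen hint j x
  · simpa using Finset.card_image_le (s := Finset.univ) (f := v)

end CD
end

section
/- Let K > 0 and N > 1, and let (P_t) be a tracially symmetric quantum Markov semigroup on M_n(ℂ) satisfying BE(K,N). If λ₁ is the smallest non-zero eigenvalue of the generator L (a positive self-adjoint operator on the Hilbert space (M_n(ℂ), ⟨·,·⟩)), then λ₁ ≥ KN/(N−1). -/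
open Matrix Filter
open scoped ComplexOrder ENNReal Kronecker

namespace CD

/-- A function bounded above on `[0, ∞)` by its value at `0` has nonpositive derivative there. -/
lemma deriv_nonpos_of_le_zero_value {f : ℝ → ℝ} {f' : ℝ} (hf : HasDerivAt f f' 0)
    (hle : ∀ t, 0 ≤ t → f t ≤ f 0) : f' ≤ 0 := by
  have h := (hasDerivWithinAt_iff_tendsto_slope' (s := Set.Ioi (0:ℝ)) (by simp)).1
    hf.hasDerivWithinAt
  refine le_of_tendsto h ?_
  filter_upwards [self_mem_nhdsWithin] with t ht
  have ht : 0 < t := ht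
  rw [slope_def_field, sub_zero]
  exact div_nonpos_of_nonpos_of_nonneg (sub_nonpos.2 (hle t ht.le)) ht.le

lemma TraciallySymm.trace_mul {n : ℕ} {Q : QMS (Fin n)} (h : TraciallySymm Q) {t : ℝ}
    (ht : 0 ≤ t) (x y : Mat (Fin n)) : (Q.P t x * y).trace = (x * Q.P t y).trace := by
  rcases Nat.eq_zero_or_pos n with rfl | hn
  · simp [Matrix.trace]
  · have := h t ht x y
    simp only [trn, Fintype.card_fin] at this
    exact mul_left_cancel₀ (inv_ne_zero (by exact_mod_cast hn.ne')) this

lemma TraciallySymm.trace_P {n : ℕ} {Q : QMS (Fin n)} (h : TraciallySymm Q) {t : ℝ}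
    (ht : 0 ≤ t) (x : Mat (Fin n)) : (Q.P t x).trace = x.trace := by
  simpa [Q.P_unital t ht] using h.trace_mul ht x 1

lemma QMS.hasDerivAt_trace_mul {ι : Type*} [Fintype ι] [DecidableEq ι] (Q : QMS ι) (y x : Mat ι) :
    HasDerivAt (fun t : ℝ => (y * Q.P t x).trace) (-(y * Q.gen x).trace) 0 := by
  simp only [Matrix.trace, Matrix.diag, Matrix.mul_apply, ← Finset.sum_neg_distrib, ← mul_neg]
  exact HasDerivAt.fun_sum fun i _ => HasDerivAt.fun_sum fun j _ =>
    (Q.P_deriv x j i).const_mul (y i j)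

lemma TraciallySymm.trace_gen {n : ℕ} {Q : QMS (Fin n)} (h : TraciallySymm Q)
    (x : Mat (Fin n)) : (Q.gen x).trace = 0 := by
  have hd := (Q.hasDerivAt_trace_mul 1 x).hasDerivWithinAt (s := Set.Ici 0)
  simp only [one_mul] at hd
  have hc : HasDerivWithinAt (fun t : ℝ => (Q.P t x).trace) 0 (Set.Ici 0) 0 :=
    (hasDerivWithinAt_const (0 : ℝ) (Set.Ici 0) x.trace).congr
      (fun t ht => h.trace_P ht x) (h.trace_P le_rfl x)
  simpa using (uniqueDiffOn_Ici (0 : ℝ) 0 Set.self_mem_Ici).eq_deriv _ hd hc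

/-- The traced Kadison–Schwarz inequality for completely positive unital maps. -/
lemma IsCP.trace_schwarz {ι : Type*} [Fintype ι] [DecidableEq ι]
    {Φ : Mat ι →ₗ[ℂ] Mat ι} (hΦ : IsCP Φ) (h1 : Φ 1 = 1) (a : Mat ι) :
    (Φ aᴴ * Φ a).trace ≤ (Φ (aᴴ * a)).trace := by
  let x : Fin 2 → Mat ι := ![a, 1]
  let r : Fin 2 → Mat ι := ![1, -Φ a]
  let X : Matrix ι (Fin 2 × ι) ℂ := Matrix.of fun i p => x p.1 i p.2
  let R : Matrix (Fin 2 × ι) ι ℂ := Matrix.of fun p i => r p.1 p.2 i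
  have hB : blockify (fun j k => (x j)ᴴ * x k) = Xᴴ * X := by
    ext p q
    simp [blockify, X, Matrix.mul_apply]
  have hpos := hΦ 2 (fun j k => (x j)ᴴ * x k)
    (hB ▸ Matrix.posSemidef_conjTranspose_mul_self X)
  have key := (hpos.conjTranspose_mul_mul_same R).trace_nonneg
  have hR : ∀ C : Fin 2 → Fin 2 → Mat ι,
      Rᴴ * blockify C * R = ∑ k, (∑ j, (r j)ᴴ * C j k) * r k := by
    intro C
    ext i i'
    simp [blockify, R, Matrix.mul_apply, Fintype.sum_prod_type, Matrix.add_apply]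
  rw [hR] at key
  simp [x, r, Fin.sum_univ_two, h1] at key
  simpa [add_mul] using key

lemma TraciallySymm.re_trace_gen_nonneg {n : ℕ} {Q : QMS (Fin n)} (h : TraciallySymm Q)
    (a : Mat (Fin n)) : 0 ≤ (aᴴ * Q.gen a).trace.re := by
  have hd : HasDerivAt (fun t : ℝ => (aᴴ * Q.P t a).trace.re)
      (-(aᴴ * Q.gen a).trace).re 0 :=
    (Complex.reCLM.hasFDerivAt.comp_hasDerivAt (0 : ℝ) (Q.hasDerivAt_trace_mul aᴴ a))
  have := deriv_nonpos_of_le_zero_value hd fun t ht => by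
    have ht2 : 0 ≤ t / 2 := by positivity
    have hs := IsCP.trace_schwarz (Q.P_cp _ ht2) (Q.P_unital _ ht2) a
    rw [h.trace_P ht2, h.trace_mul ht2, ← LinearMap.comp_apply, ← Q.P_add, add_halves] at hs
    simpa [Q.P_zero] using (Complex.le_def.1 hs).1
  simpa using this

/-- (Poincaré inequality.) If a tracially symmetric quantum Markov
semigroup on `Mₙ(ℂ)` satisfies `BE(K,N)` with `K > 0`, `N > 1`, and `λ₁` is the
smallest non-zero eigenvalue of the generator `L`, then `λ₁ ≥ KN/(N−1)`. -/
theorem poincare_of_BE {n : ℕ} (Q : QMS (Fin n)) (hsymm : TraciallySymm Q)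
    (K N : ℝ) (hK : 0 < K) (hN : 1 < N) (hBE : BE Q.gen K N⁻¹) (lam₁ : ℝ)
    (h₁ : Module.End.HasEigenvalue (Q.gen : Module.End ℂ (Mat (Fin n))) (lam₁ : ℂ))
    (hne : lam₁ ≠ 0)
    (hmin : ∀ μ : ℝ,
      Module.End.HasEigenvalue (Q.gen : Module.End ℂ (Mat (Fin n))) (μ : ℂ) →
        μ ≠ 0 → lam₁ ≤ μ) :
    K * N / (N - 1) ≤ lam₁ := by
  obtain ⟨a, ha⟩ := h₁.exists_hasEigenvector
  have hLa : Q.gen a = (lam₁ : ℂ) • a := ha.apply_eq_smul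
  have hnn : 0 ≤ (aᴴ * a).trace := (Matrix.posSemidef_conjTranspose_mul_self a).trace_nonneg
  obtain ⟨r, hr⟩ : ∃ r : ℝ, (aᴴ * a).trace = r := ⟨_, (Complex.eq_re_of_ofReal_le hnn)⟩
  have hr0 : 0 < r := by
    have h0 : (aᴴ * a).trace ≠ 0 :=
      fun h => ha.2 (Matrix.trace_conjTranspose_mul_self_eq_zero_iff.1 h)
    rw [hr] at hnn h0
    exact lt_of_le_of_ne (by exact_mod_cast hnn) (by exact_mod_cast h0.symm)
  have hlam : 0 < lam₁ := by
    have h := hsymm.re_trace_gen_nonneg a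
    simp only [hLa, Matrix.mul_smul, Matrix.trace_smul, hr, smul_eq_mul, ← Complex.ofReal_mul,
      Complex.ofReal_re] at h
    exact lt_of_le_of_ne (nonneg_of_mul_nonneg_left h hr0) hne.symm
  have hb := (hBE a).trace_nonneg
  simp only [Gamma2, Gamma, hLa, map_smul, Matrix.trace_sub, Matrix.trace_add, Matrix.trace_smul,
    Matrix.conjTranspose_smul, Matrix.smul_mul, Matrix.mul_smul, hsymm.trace_gen, hr] at hb
  simp at hb
  have hb := (Complex.le_def.1 hb).1
  simp at hb
  have hle : (K + N⁻¹ * lam₁) * (lam₁ * r) ≤ lam₁ * (lam₁ * r) := by linarith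
  have hle := le_of_mul_le_mul_right hle (mul_pos hlam hr0)
  rw [div_le_iff₀ (sub_pos.2 hN)]
  have hN0 : N * N⁻¹ = 1 := mul_inv_cancel₀ (by linarith)
  have hmul := mul_le_mul_of_nonneg_left hle (by linarith : (0:ℝ) ≤ N)
  linear_combination hmul - lam₁ * hN0

end CD
end

section
/- Let K, N ∈ (0,∞) and let (P_t) be a tracially symmetric quantum Markov semigroup on M_n(ℂ) that is ergodic (P_t ρ → 1 as t → ∞ for every density matrix ρ) and satisfies BE(K,N). Then d_Γ(ρ, 1) ≤ (π/2)·√(N/K) for every density matrix ρ; in particular, d_Γ(ρ₀, ρ₁) ≤ π·√(N/K) for all density matrices ρ₀, ρ₁. -/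
open Matrix Filter
open scoped ComplexOrder ENNReal Kronecker

namespace CD

def Ergodic' {ι : Type*} [Fintype ι] [DecidableEq ι] (Q : QMS ι) : Prop :=
  ∀ ρ : Mat ι, IsDensity ρ → ∀ i j : ι,
    Filter.Tendsto (fun t : ℝ => Q.P t ρ i j) Filter.atTop (nhds ((1 : Mat ι) i j))


section Helpers

open scoped Matrix.Norms.Operator

variable {ι : Type*} [Fintype ι]

theorem trn_mul_re_nonneg {A B : Mat ι} (hA : A.PosSemidef) (hB : B.PosSemidef) :
    0 ≤ (trn (A * B)).re := by
  have htrace : 0 ≤ (A * B).trace := by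
    obtain ⟨m, v, rfl⟩ := Matrix.posSemidef_iff_eq_sum_vecMulVec.mp hA
    rw [Finset.sum_mul, Matrix.trace_sum]
    refine Finset.sum_nonneg fun i _ => ?_
    rw [Matrix.trace_mul_comm, Matrix.mul_vecMulVec, Matrix.trace_vecMulVec, dotProduct_comm]
    exact hB.dotProduct_mulVec_nonneg _
  have hcard : (0 : ℂ) ≤ (Fintype.card ι : ℂ)⁻¹ := by positivity
  exact (Complex.le_def.mp (mul_nonneg hcard htrace)).1

/-- The real part of the trace pairing, as a real bilinear map. -/
noncomputable def pairing : Mat ι →ₗ[ℝ] Mat ι →ₗ[ℝ] ℝ :=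
  LinearMap.mk₂ ℝ (fun x y => (trn (x * y)).re)
    (by intros; simp [trn, add_mul, mul_add])
    (by intros; simp only [trn, smul_mul_assoc, Matrix.trace_smul, mul_smul_comm,
          Complex.smul_re])
    (by intros; simp [trn, mul_add])
    (by intros; simp only [trn, Matrix.trace_smul, mul_smul_comm, Complex.smul_re])

theorem pairing_apply (x y : Mat ι) : pairing x y = (trn (x * y)).re := rfl

theorem pairing_mono {ρ A B : Mat ι} (hρ : ρ.PosSemidef) (h : matLE A B) :
    pairing ρ A ≤ pairing ρ B := by
  have := trn_mul_re_nonneg hρ h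
  rw [← pairing_apply, map_sub] at this
  linarith

theorem IsCP.map_posSemidef {Φ : Mat ι →ₗ[ℂ] Mat ι} (hΦ : IsCP Φ) {x : Mat ι}
    (hx : x.PosSemidef) : (Φ x).PosSemidef := by
  have h := hΦ 1 (fun _ _ => x) (hx.submatrix (fun p : Fin 1 × ι => p.2))
  exact h.submatrix (fun i : ι => ((0 : Fin 1), i))

theorem hasDerivAt_matrix {x : ℝ → Mat ι} {x' : Mat ι} {t : ℝ}
    (h : ∀ i j, HasDerivAt (fun s => x s i j) (x' i j) t) : HasDerivAt x x' t :=
  hasDerivAt_pi.2 fun i => hasDerivAt_pi.2 fun j => h i j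

theorem hasDerivAt_matrix_map {x : ℝ → Mat ι} {x' : Mat ι} {t : ℝ} (h : HasDerivAt x x' t)
    (Φ : Mat ι →ₗ[ℂ] Mat ι) : HasDerivAt (fun s => Φ (x s)) (Φ x') t :=
  (LinearMap.toContinuousLinearMap (Φ.restrictScalars ℝ)).hasFDerivAt.comp_hasDerivAt t h

theorem hasDerivAt_matrix_conjTranspose {x : ℝ → Mat ι} {x' : Mat ι} {t : ℝ}
    (h : HasDerivAt x x' t) : HasDerivAt (fun s => (x s)ᴴ) x'ᴴ t :=
  hasDerivAt_matrix fun i j => (hasDerivAt_pi.1 (hasDerivAt_pi.1 h j) i).star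

variable [DecidableEq ι]

theorem sq_pairing_le {ρ : Mat ι} (hρ : IsDensity ρ) (x : Mat ι) :
    pairing ρ x ^ 2 ≤ pairing ρ (xᴴ * x) := by
  set c := pairing ρ x with hc
  have h := trn_mul_re_nonneg hρ.1 (posSemidef_conjTranspose_mul_self (x - c • (1 : Mat ι)))
  have h1 : pairing ρ (1 : Mat ι) = 1 := by simp [pairing_apply, hρ.2]
  have hstar : pairing ρ xᴴ = c := by
    rw [hc, pairing_apply, pairing_apply, ← Complex.conj_re (trn (ρ * x))]
    congr 1
    simp only [trn, map_mul, map_inv₀, map_natCast, starRingEnd_apply, ← trace_conjTranspose,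
      conjTranspose_mul, hρ.1.isHermitian.eq]
    rw [Matrix.trace_mul_comm]
  have hexp : (x - c • (1 : Mat ι))ᴴ * (x - c • (1 : Mat ι))
      = xᴴ * x - c • x - c • xᴴ + (c * c) • (1 : Mat ι) := by
    simp only [conjTranspose_sub, conjTranspose_smul, conjTranspose_one, sub_mul, mul_sub,
      smul_mul_assoc, mul_smul_comm, one_mul, mul_one, star_trivial,
      smul_sub, smul_smul]
    abel
  rw [← pairing_apply, hexp] at h
  simp only [map_add, map_sub, map_smul, h1, hstar, ← hc, smul_eq_mul] at h
  nlinarith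

/-- The Kadison–Schwarz inequality for unital completely positive maps. -/
theorem IsCP.kadison_schwarz_s5 {Φ : Mat ι →ₗ[ℂ] Mat ι} (hΦ : IsCP Φ) (h1 : Φ 1 = 1)
    (b : Mat ι) : matLE ((Φ b)ᴴ * Φ b) (Φ (bᴴ * b)) := by
  let r : Fin 2 → Mat ι := ![1, b]
  let X : Matrix ι (Fin 2 × ι) ℂ := Matrix.of fun i p => r p.1 i p.2
  have hX : blockify (fun j k => (r j)ᴴ * r k) = Xᴴ * X := by
    ext p q
    simp [blockify, X, Matrix.mul_apply]
  have h := hΦ 2 (fun j k => (r j)ᴴ * r k) (hX ▸ posSemidef_conjTranspose_mul_self X)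
  have hstar : Φ bᴴ = (Φ b)ᴴ := by
    ext i j
    have := congr_fun (congr_fun h.isHermitian ((1 : Fin 2), i)) ((0 : Fin 2), j)
    simpa [blockify, r, Matrix.conjTranspose_apply] using this.symm
  let s : Fin 2 → Mat ι := ![-Φ b, 1]
  let Y : Matrix (Fin 2 × ι) ι ℂ := Matrix.of fun p i => s p.1 p.2 i
  have hY := h.conjTranspose_mul_mul_same Y
  have hcalc : Yᴴ * (blockify fun j k => Φ ((r j)ᴴ * r k)) * Y
      = ∑ k, (∑ j, (s j)ᴴ * Φ ((r j)ᴴ * r k)) * s k := by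
    ext p q
    simp [blockify, Y, Matrix.mul_apply, Matrix.sum_apply, Fintype.sum_prod_type]
  rw [hcalc] at hY
  simpa [matLE, Fin.sum_univ_two, r, s, h1, hstar, neg_add_eq_sub] using hY

theorem hasDerivAt_pairing {x y : ℝ → Mat ι} {x' y' : Mat ι} {t : ℝ}
    (hx : HasDerivAt x x' t) (hy : HasDerivAt y y' t) :
    HasDerivAt (fun s => pairing (x s) (y s)) (pairing x' (y t) + pairing (x t) y') t := by
  have h := (LinearMap.toContinuousLinearMap
    (pairing (1 : Mat ι))).hasFDerivAt.comp_hasDerivAt t (hx.mul hy)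
  refine (h.congr_deriv ?_).congr_of_eventuallyEq (.of_forall fun s => ?_)
  · change pairing (1 : Mat ι) (x' * y t + x t * y') = _
    simp [pairing_apply, trn, mul_add]
  · change _ = pairing (1 : Mat ι) (x s * y s)
    simp [pairing_apply]

theorem hasDerivAt_Gamma {x y : ℝ → Mat ι} {x' y' : Mat ι} {t : ℝ} (L : Mat ι →ₗ[ℂ] Mat ι)
    (hx : HasDerivAt x x' t) (hy : HasDerivAt y y' t) :
    HasDerivAt (fun s => Gamma L (x s) (y s)) (Gamma L x' (y t) + Gamma L (x t) y') t := by
  have hxs := hasDerivAt_matrix_conjTranspose hx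
  have hlx := hasDerivAt_matrix_conjTranspose (hasDerivAt_matrix_map hx L)
  have h := (((hxs.mul (hasDerivAt_matrix_map hy L)).add (hlx.mul hy)).sub
    (hasDerivAt_matrix_map (hxs.mul hy) L)).const_smul ((2 : ℂ)⁻¹)
  refine h.congr_deriv ?_
  simp only [Gamma, map_add, ← smul_add]
  congr 1
  abel

namespace QMS

variable (Q : QMS ι)

theorem hasDerivAt (x : Mat ι) (t : ℝ) :
    HasDerivAt (fun s => Q.P s x) (-Q.gen (Q.P t x)) t := by
  have h0 : HasDerivAt (fun s => Q.P s (Q.P t x)) (-Q.gen (Q.P t x)) (t - t) := by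
    rw [sub_self]
    exact hasDerivAt_matrix fun i j => Q.P_deriv _ i j
  refine (h0.comp_sub_const t t).congr_of_eventuallyEq (.of_forall fun s => ?_)
  change Q.P s x = (Q.P (s - t) ∘ₗ Q.P t) x
  rw [← Q.P_add, sub_add_cancel]

theorem P_comm_gen (x : Mat ι) (t : ℝ) : Q.P t (Q.gen x) = Q.gen (Q.P t x) := by
  have h0 := Q.hasDerivAt x 0
  rw [Q.P_zero, LinearMap.id_apply] at h0
  have h1 := hasDerivAt_matrix_map h0 (Q.P t)
  have h2 := Q.hasDerivAt (Q.P t x) 0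
  rw [Q.P_zero, LinearMap.id_apply] at h2
  have h3 := h1.unique (h2.congr_of_eventuallyEq (.of_forall fun s => by
    change (Q.P t ∘ₗ Q.P s) x = (Q.P s ∘ₗ Q.P t) x
    rw [← Q.P_add, ← Q.P_add, add_comm]))
  rwa [map_neg, neg_inj] at h3

theorem P_P (s t : ℝ) (x : Mat ι) : Q.P s (Q.P t x) = Q.P (s + t) x := by
  rw [Q.P_add, LinearMap.comp_apply]

variable {Q}

theorem pairing_symm (hQ : TraciallySymm Q) {t : ℝ} (ht : 0 ≤ t) (x y : Mat ι) :
    pairing (Q.P t x) y = pairing x (Q.P t y) := by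
  rw [pairing_apply, pairing_apply, hQ t ht]

theorem pairing_symm_gen (hQ : TraciallySymm Q) (x y : Mat ι) :
    pairing (Q.gen x) y = pairing x (Q.gen y) := by
  have hd : ∀ z, HasDerivAt (fun s => Q.P s z) (-Q.gen z) 0 := fun z => by
    simpa [Q.P_zero] using Q.hasDerivAt z 0
  have h1 := (hasDerivAt_pairing (hd x) (hasDerivAt_const (0 : ℝ) y)).hasDerivWithinAt (s := Set.Ici 0)
  have h2 := (hasDerivAt_pairing (hasDerivAt_const (0 : ℝ) x) (hd y)).hasDerivWithinAt (s := Set.Ici 0)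
  have h3 := (uniqueDiffOn_Ici (0 : ℝ) 0 Set.self_mem_Ici).eq_deriv _ h1
    (h2.congr (fun s hs => pairing_symm hQ hs x y) (pairing_symm hQ le_rfl x y))
  simpa using h3

theorem isDensity_P (hQ : TraciallySymm Q) {ρ : Mat ι} (hρ : IsDensity ρ) {t : ℝ}
    (ht : 0 ≤ t) : IsDensity (Q.P t ρ) := by
  refine ⟨(Q.P_cp t ht).map_posSemidef hρ.1, ?_⟩
  have := hQ t ht ρ 1
  rwa [Q.P_unital t ht, mul_one, mul_one, hρ.2] at this

theorem pairing_Gamma_nonneg (Q : QMS ι) {ρ : Mat ι} (hρ : ρ.PosSemidef) (b : Mat ι) :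
    0 ≤ pairing ρ (Gamma Q.gen b b) := by
  have hd : ∀ z, HasDerivAt (fun s => Q.P s z) (-Q.gen z) 0 := fun z => by
    simpa [Q.P_zero] using Q.hasDerivAt z 0
  have h := hasDerivAt_pairing (hasDerivAt_const (0 : ℝ) ρ)
    ((hd (bᴴ * b)).sub ((hasDerivAt_matrix_conjTranspose (hd b)).mul (hd b)))
  have hval : Gamma Q.gen b b = (2 : ℝ)⁻¹ •
      (-Q.gen (bᴴ * b) - ((-Q.gen b)ᴴ * Q.P 0 b + (Q.P 0 b)ᴴ * -Q.gen b)) := by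
    rw [Gamma, Q.P_zero, ← Complex.coe_smul]
    simp only [LinearMap.id_apply, conjTranspose_neg, neg_mul, mul_neg]
    push_cast
    congr 1
    abel
  rw [hval, map_smul, smul_eq_mul]
  refine mul_nonneg (by norm_num) ?_
  have hmin : ∀ s ∈ Set.Ici (0 : ℝ),
      0 ≤ pairing ρ (Q.P s (bᴴ * b) - (Q.P s b)ᴴ * Q.P s b) := fun s hs =>
    trn_mul_re_nonneg hρ ((Q.P_cp s hs).kadison_schwarz_s5 (Q.P_unital s hs) b)
  have h0 : pairing ρ (Q.P 0 (bᴴ * b) - (Q.P 0 b)ᴴ * Q.P 0 b) = 0 := by simp [Q.P_zero]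
  by_contra! hneg
  have hslope := (hasDerivWithinAt_iff_tendsto_slope' (Set.self_notMem_Ioi)).1
    (h.hasDerivWithinAt (s := Set.Ioi 0))
  rw [map_zero, LinearMap.zero_apply, zero_add] at hslope
  obtain ⟨s, hs, hs0⟩ := ((hslope.eventually (gt_mem_nhds hneg)).and
    self_mem_nhdsWithin).exists
  rw [slope_def_field] at hs
  have := div_nonneg (sub_nonneg.2 (h0.trans_le (hmin s (le_of_lt hs0))))
    (sub_nonneg.2 (le_of_lt hs0))
  exact absurd hs (not_lt.2 this)

theorem hasDerivAt_pairing_P_Gamma (hQ : TraciallySymm Q) (ρ a : Mat ι) (t s : ℝ) :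
    HasDerivAt (fun s => pairing (Q.P s ρ) (Gamma Q.gen (Q.P (t - s) a) (Q.P (t - s) a)))
      (2 * pairing (Q.P s ρ) (Gamma2 Q.gen (Q.P (t - s) a) (Q.P (t - s) a))) s := by
  have hb : HasDerivAt (fun s => Q.P (t - s) a) (Q.gen (Q.P (t - s) a)) s := by
    have h := HasDerivAt.scomp s (Q.hasDerivAt a (t - s)) ((hasDerivAt_id s).const_sub t)
    rw [neg_one_smul, neg_neg] at h
    exact h
  have h := hasDerivAt_pairing (Q.hasDerivAt ρ s) (hasDerivAt_Gamma Q.gen hb hb)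
  refine h.congr_deriv ?_
  have h2 : ∀ x y : Mat ι, pairing x ((2 : ℂ)⁻¹ • y) = (2 : ℝ)⁻¹ * pairing x y := by
    intro x y
    rw [← smul_eq_mul, ← map_smul, ← Complex.coe_smul]
    push_cast
    rfl
  rw [Gamma2, h2]
  simp only [map_neg, map_add, map_sub, LinearMap.neg_apply, pairing_symm_gen hQ]
  ring

/-- The dimensional gradient estimate: if `Γ(a) ≤ 1`, then
`|τ(ρ L P_t a)|² ≤ KN / (exp(2Kt) - 1)`. -/
theorem sq_pairing_gen_le (hQ : TraciallySymm Q) {K N : ℝ} (hK : 0 < K) (hN : 0 < N)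
    (hBE : BE Q.gen K N⁻¹) {ρ : Mat ι} (hρ : IsDensity ρ) {a : Mat ι}
    (ha : matLE (Gamma Q.gen a a) 1) {t : ℝ} (ht : 0 ≤ t) :
    (Real.exp (2 * K * t) - 1) * pairing ρ (Q.gen (Q.P t a)) ^ 2 ≤ K * N := by
  set c := pairing ρ ((Q.gen (Q.P t a))ᴴ * Q.gen (Q.P t a)) with hc
  let φ : ℝ → ℝ := fun s => Real.exp (-(2 * K * s)) *
    (pairing (Q.P s ρ) (Gamma Q.gen (Q.P (t - s) a) (Q.P (t - s) a)) + c / (K * N))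
  have hφ : ∀ s, HasDerivAt φ _ s := fun s =>
    (((hasDerivAt_id s).const_mul (2 * K)).neg.exp).mul
      ((hasDerivAt_pairing_P_Gamma hQ ρ a t s).add_const (c / (K * N)))
  have hmono : MonotoneOn φ (Set.Icc 0 t) := by
    refine monotoneOn_of_hasDerivWithinAt_nonneg (convex_Icc 0 t)
      (fun s _ => (hφ s).continuousAt.continuousWithinAt)
      (fun s _ => (hφ s).hasDerivWithinAt) fun s hs => ?_
    rw [interior_Icc] at hs
    have hs0 : 0 ≤ s := hs.1.le
    set b := Q.P (t - s) a with hb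
    have hσ := isDensity_P hQ hρ hs0
    have h1 := pairing_mono hσ.1 (hBE b)
    have h2 := pairing_mono hρ.1
      ((Q.P_cp s hs0).kadison_schwarz_s5 (Q.P_unital s hs0) (Q.gen b))
    rw [P_comm_gen, hb, P_P, add_sub_cancel, ← hb, ← hc, ← pairing_symm hQ hs0] at h2
    simp only [map_add, map_smul, smul_eq_mul] at h1
    have h3 := mul_le_mul_of_nonneg_left h2 (inv_nonneg.2 hN.le)
    have h4 : K * (c / (K * N)) = N⁻¹ * c := by field_simp
    have h5 := Real.exp_pos (-(2 * K * s))
    simp only [id_eq, Pi.neg_apply, mul_one]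
    rw [mul_neg, neg_mul, mul_assoc, neg_add_eq_sub, ← mul_sub]
    refine mul_nonneg h5.le ?_
    linarith
  have hle := hmono (Set.left_mem_Icc.2 ht) (Set.right_mem_Icc.2 ht) ht
  have h0 := Q.pairing_Gamma_nonneg hρ.1 (Q.P t a)
  have h1 : pairing (Q.P t ρ) (Gamma Q.gen a a) ≤ 1 := by
    have hσ := isDensity_P hQ hρ ht
    refine (pairing_mono hσ.1 ha).trans_eq ?_
    simp [pairing_apply, hσ.2]
  simp only [φ, sub_zero, sub_self, mul_zero, neg_zero, Real.exp_zero, one_mul, Q.P_zero,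
    LinearMap.id_apply] at hle
  have hsq : pairing ρ (Q.gen (Q.P t a)) ^ 2 ≤ c := sq_pairing_le hρ _
  have hE : 1 ≤ Real.exp (2 * K * t) := Real.one_le_exp (by positivity)
  have hprod : Real.exp (2 * K * t) * Real.exp (-(2 * K * t)) = 1 := by
    rw [← Real.exp_add, add_neg_cancel, Real.exp_zero]
  have hle' : Real.exp (2 * K * t) * (c / (K * N)) ≤ 1 + c / (K * N) := by
    calc Real.exp (2 * K * t) * (c / (K * N))
        ≤ Real.exp (2 * K * t) * (Real.exp (-(2 * K * t)) *
          (pairing (Q.P t ρ) (Gamma Q.gen a a) + c / (K * N))) := by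
          gcongr; linarith
      _ = pairing (Q.P t ρ) (Gamma Q.gen a a) + c / (K * N) := by
          rw [← mul_assoc, hprod, one_mul]
      _ ≤ _ := by gcongr
  have hfin : (Real.exp (2 * K * t) - 1) * c ≤ K * N := by
    have h6 : (Real.exp (2 * K * t) - 1) * c / (K * N) ≤ 1 := by
      rw [mul_div_assoc]; linarith
    rwa [div_le_one (by positivity)] at h6
  exact (mul_le_mul_of_nonneg_left hsq (by linarith)).trans hfin

theorem pairing_sub_pairing_P_le (hQ : TraciallySymm Q) {K N : ℝ} (hK : 0 < K) (hN : 0 < N)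
    (hBE : BE Q.gen K N⁻¹) {ρ : Mat ι} (hρ : IsDensity ρ) {a : Mat ι}
    (ha : matLE (Gamma Q.gen a a) 1) {t : ℝ} (ht : 0 ≤ t) :
    pairing ρ a - pairing ρ (Q.P t a) ≤ Real.pi / 2 * Real.sqrt (N / K) := by
  let w : ℝ → ℝ := fun s => Real.sqrt (Real.exp (2 * K * s) - 1)
  let h : ℝ → ℝ := fun s => pairing ρ (Q.P s a) + Real.sqrt (N / K) * Real.arctan (w s)
  have hf : ∀ s, HasDerivAt (fun s => pairing ρ (Q.P s a))
      (-pairing ρ (Q.gen (Q.P s a))) s := fun s => by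
    simpa using hasDerivAt_pairing (hasDerivAt_const s ρ) (Q.hasDerivAt a s)
  have hcont : Continuous h := by
    refine Continuous.add (continuous_iff_continuousAt.2 fun s => (hf s).continuousAt) ?_
    fun_prop
  have hder : ∀ s, 0 < s → HasDerivAt h (-pairing ρ (Q.gen (Q.P s a)) +
      Real.sqrt (N / K) * (K / w s)) s := fun s hs => by
    have hE : 0 < Real.exp (2 * K * s) - 1 := by
      have := Real.one_lt_exp_iff.2 (show 0 < 2 * K * s by positivity)
      linarith
    have hw := ((((hasDerivAt_id s).const_mul (2 * K)).exp.sub_const 1).sqrt hE.ne').arctan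
    refine (hf s).add ((hw.congr_deriv ?_).const_mul _)
    have hwpos : 0 < Real.sqrt (Real.exp (2 * K * s) - 1) := Real.sqrt_pos.2 hE
    simp only [id_eq, w, Real.sq_sqrt hE.le]
    have := Real.exp_pos (2 * K * s)
    rw [add_sub_cancel]
    field_simp
  have hmono : MonotoneOn h (Set.Icc 0 t) := by
    refine monotoneOn_of_hasDerivWithinAt_nonneg (convex_Icc 0 t) hcont.continuousOn
      (fun s hs => (hder s (by rw [interior_Icc] at hs; exact hs.1)).hasDerivWithinAt)
      fun s hs => ?_
    rw [interior_Icc] at hs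
    have hE : 0 < Real.exp (2 * K * s) - 1 := by
      have := Real.one_lt_exp_iff.2 (show 0 < 2 * K * s from mul_pos (by positivity) hs.1)
      linarith
    have hwpos : 0 < w s := Real.sqrt_pos.2 hE
    have hest := sq_pairing_gen_le hQ hK hN hBE hρ ha hs.1.le
    have hle : pairing ρ (Q.gen (Q.P s a)) ≤ Real.sqrt (N / K) * (K / w s) := by
      refine le_of_sq_le_sq ?_ (by positivity)
      rw [mul_pow, div_pow, Real.sq_sqrt (by positivity), Real.sq_sqrt hE.le]
      have hval : N / K * (K ^ 2 / (Real.exp (2 * K * s) - 1))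
          = K * N / (Real.exp (2 * K * s) - 1) := by field_simp
      rw [hval, le_div_iff₀ hE, mul_comm]
      exact hest
    linarith
  have hle := hmono (Set.left_mem_Icc.2 ht) (Set.right_mem_Icc.2 ht) ht
  have harc : Real.sqrt (N / K) * Real.arctan (w t) ≤ Real.sqrt (N / K) * (Real.pi / 2) := by
    gcongr
    exact (Real.arctan_lt_pi_div_two _).le
  simp only [h, w, mul_zero, Real.exp_zero, sub_self, Real.sqrt_zero, Real.arctan_zero,
    add_zero, Q.P_zero, LinearMap.id_apply] at hle harc
  linarith

theorem pairing_sub_le (hQ : TraciallySymm Q) {K N : ℝ} (hK : 0 < K) (hN : 0 < N)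
    (herg : Ergodic' Q) (hBE : BE Q.gen K N⁻¹) {ρ : Mat ι} (hρ : IsDensity ρ) {a : Mat ι}
    (ha : matLE (Gamma Q.gen a a) 1) :
    (trn (a * (ρ - 1))).re ≤ Real.pi / 2 * Real.sqrt (N / K) := by
  have hlim : Tendsto (fun t => Q.P t ρ) atTop (nhds 1) :=
    tendsto_pi_nhds.2 fun i => tendsto_pi_nhds.2 fun j => herg ρ hρ i j
  have hlim' : Tendsto (fun t => pairing a (ρ - Q.P t ρ)) atTop
      (nhds (pairing a (ρ - 1))) :=
    (LinearMap.continuous_of_finiteDimensional (pairing a)).continuousAt.tendsto.comp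
      (hlim.const_sub ρ)
  refine le_of_tendsto hlim' ?_
  filter_upwards [eventually_ge_atTop 0] with t ht
  have hcomm : ∀ x y : Mat ι, pairing x y = pairing y x := fun x y => by
    simp only [pairing_apply, trn, Matrix.trace_mul_comm x y]
  rw [map_sub, hcomm a ρ, hcomm a, pairing_symm hQ ht]
  exact pairing_sub_pairing_P_le hQ hK hN hBE hρ ha ht

end QMS

end Helpers

/-- (Bonnet–Myers.) If a tracially symmetric, ergodic quantum Markov
semigroup on `Mₙ(ℂ)` satisfies `BE(K,N)` with `K, N ∈ (0,∞)`, then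
`d_Γ(ρ, 1) ≤ (π/2)√(N/K)` for every density matrix `ρ`, and in particular
`d_Γ(ρ₀, ρ₁) ≤ π√(N/K)` for all density matrices `ρ₀, ρ₁`; here
`d_Γ(ρ₀,ρ₁) = sup{ τ(a(ρ₁−ρ₀)) : a = a*, Γ(a) ≤ 1 }`. -/
theorem bonnetMyers_of_BE {n : ℕ} (Q : QMS (Fin n)) (hsymm : TraciallySymm Q)
    (K N : ℝ) (hK : 0 < K) (hN : 0 < N) (herg : Ergodic' Q) (hBE : BE Q.gen K N⁻¹) :
    (∀ ρ : Mat (Fin n), IsDensity ρ →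
      ∀ a : Mat (Fin n), a.IsHermitian → matLE (Gamma Q.gen a a) 1 →
        (trn (a * (ρ - 1))).re ≤ Real.pi / 2 * Real.sqrt (N / K)) ∧
    (∀ ρ₀ ρ₁ : Mat (Fin n), IsDensity ρ₀ → IsDensity ρ₁ →
      ∀ a : Mat (Fin n), a.IsHermitian → matLE (Gamma Q.gen a a) 1 →
        (trn (a * (ρ₁ - ρ₀))).re ≤ Real.pi * Real.sqrt (N / K)) := by
  have hmain := fun ρ (hρ : IsDensity ρ) (a : Mat (Fin n)) (ha : matLE (Gamma Q.gen a a) 1) =>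
    QMS.pairing_sub_le hsymm hK hN herg hBE hρ ha
  refine ⟨fun ρ hρ a _ ha => hmain ρ hρ a ha, fun ρ₀ ρ₁ hρ₀ hρ₁ a _ ha => ?_⟩
  have hneg : matLE (Gamma Q.gen (-a) (-a)) 1 := by simpa [Gamma] using ha
  have h₁ := hmain ρ₁ hρ₁ a ha
  have h₀ := hmain ρ₀ hρ₀ (-a) hneg
  have hsplit : (trn (a * (ρ₁ - ρ₀))).re
      = (trn (a * (ρ₁ - 1))).re + (trn (-a * (ρ₀ - 1))).re := by
    rw [← Complex.add_re, trn, trn, trn, ← mul_add, ← Matrix.trace_add]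
    congr 3
    noncomm_ring
  linarith

end CD
end

section
/- Let X be a finite set, μ a strictly positive probability weight on X, and (P_t) a quantum Markov semigroup on the commutative algebra ℂ^X of functions X → ℂ (with pointwise product and trace τ(f) = ∑_{x∈X} μ(x)f(x)). If (P_t) satisfies BE(K,N) for some K ∈ ℝ and N ∈ (0,∞], then (P_t) satisfies CBE(K,N): for every m and all f_1,…,f_m ∈ ℂ^X, the matrix inequality [Γ₂(f_j,f_k)]_{j,k} ≥ K·[Γ(f_j,f_k)]_{j,k} + (1/N)·[conj(L f_j)·(L f_k)]_{j,k} holds in M_m(ℂ^X), i.e. pointwise at every x ∈ X the m×m scalar matrices satisfy this inequality in the positive semidefinite order. -/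
open scoped ComplexOrder ENNReal

namespace CDComm

/-- A quantum Markov semigroup on the commutative algebra `ℂ^X` of functions on a
finite set `X`: a semigroup of positivity-preserving (equivalently, completely
positive) unital linear maps, continuous in `t`, with generator `gen` so that
`P t = e^{−t·gen}`. -/
structure QMSc (X : Type*) [Fintype X] where
  P : ℝ → (X → ℂ) →ₗ[ℂ] (X → ℂ)
  gen : (X → ℂ) →ₗ[ℂ] (X → ℂ)
  P_zero : P 0 = LinearMap.id
  P_add : ∀ s t : ℝ, P (s + t) = (P s) ∘ₗ (P t)
  P_pos : ∀ t : ℝ, 0 ≤ t → ∀ f : X → ℂ, (∀ x, 0 ≤ f x) → ∀ x, 0 ≤ P t f x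
  P_unital : ∀ t : ℝ, 0 ≤ t → P t 1 = 1
  P_cont : ∀ (f : X → ℂ) (x : X), Continuous fun t : ℝ => P t f x
  P_deriv : ∀ (f : X → ℂ) (x : X),
    HasDerivAt (fun t : ℝ => P t f x) (-(gen f x)) 0

variable {X : Type*} [Fintype X]

noncomputable def Gammac (L : (X → ℂ) →ₗ[ℂ] (X → ℂ)) (a b : X → ℂ) : X → ℂ :=
  (2:ℂ)⁻¹ • (star a * L b + star (L a) * b - L (star a * b))

noncomputable def Gamma2c (L : (X → ℂ) →ₗ[ℂ] (X → ℂ)) (a b : X → ℂ) : X → ℂ :=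
  (2:ℂ)⁻¹ • (Gammac L a (L b) + Gammac L (L a) b - L (Gammac L a b))

/-- Pointwise Bakry–Émery condition `BE(K,N)` on `ℂ^X` (`ν` plays the role of `1/N`). -/
noncomputable def BEc (L : (X → ℂ) →ₗ[ℂ] (X → ℂ)) (K ν : ℝ) : Prop :=
  ∀ (f : X → ℂ) (x : X),
    (K : ℂ) * Gammac L f f x + (ν : ℂ) * (star (L f x) * L f x) ≤ Gamma2c L f f x

open ComplexConjugate

/-- Over `ℂ`, a sesquilinear form with nonnegative diagonal is Hermitian, by polarization. -/
lemma conj_apply_eq_of_isNonneg {M : Type*} [AddCommGroup M] [Module ℂ M]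
    {B : M →ₗ⋆[ℂ] M →ₗ[ℂ] ℂ} (hB : B.IsNonneg) (u v : M) :
    conj (B u v) = B v u := by
  have him (w : M) : (B w w).im = 0 := (Complex.nonneg_iff.mp (hB.nonneg w)).2.symm
  have hadd := him (u + v)
  have haddI := him (u + Complex.I • v)
  have hu := him u
  have hv := him v
  simp only [map_add, map_smul, map_smulₛₗ, LinearMap.add_apply, LinearMap.smul_apply,
    smul_eq_mul, Complex.conj_I, Complex.add_im, Complex.mul_im, Complex.add_re, Complex.mul_re,
    Complex.neg_re, Complex.neg_im, Complex.I_re, Complex.I_im] at hadd haddI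
  apply Complex.ext
  · simp only [Complex.conj_re]
    linarith
  · simp only [Complex.conj_im]
    linarith

/-- Gram matrices of a nonnegative sesquilinear form over `ℂ` are positive semidefinite. -/
lemma posSemidef_gram_of_isNonneg {M ι : Type*} [AddCommGroup M] [Module ℂ M] [Fintype ι]
    {B : M →ₗ⋆[ℂ] M →ₗ[ℂ] ℂ} (hB : B.IsNonneg) (v : ι → M) :
    (Matrix.of fun j k => B (v j) (v k)).PosSemidef := by
  refine Matrix.posSemidef_iff_dotProduct_mulVec.mpr ⟨?_, fun c => ?_⟩
  · ext j k
    exact conj_apply_eq_of_isNonneg hB _ _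
  · have h := hB.nonneg (∑ k, c k • v k)
    simp only [map_sum, map_smul, map_smulₛₗ, LinearMap.sum_apply, LinearMap.smul_apply,
      smul_eq_mul, Finset.mul_sum] at h
    rw [Finset.sum_comm] at h
    simp only [dotProduct, Matrix.mulVec, Finset.mul_sum]
    simpa [mul_comm, mul_left_comm, mul_assoc] using h

/-- The carré du champ as a sesquilinear map. -/
noncomputable def gammaSesq (L : (X → ℂ) →ₗ[ℂ] (X → ℂ)) :
    (X → ℂ) →ₗ⋆[ℂ] (X → ℂ) →ₗ[ℂ] (X → ℂ) :=
  LinearMap.mk₂'ₛₗ (starRingEnd ℂ) (RingHom.id ℂ) (Gammac L)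
    (fun a a' b => by simp only [Gammac, map_add, star_add, add_mul]; module)
    (fun c a b => by
      simp only [Gammac, map_smul, star_smul, smul_mul_assoc, starRingEnd_apply]; module)
    (fun a b b' => by simp only [Gammac, map_add, mul_add]; module)
    (fun c a b => by simp only [Gammac, map_smul, mul_smul_comm, RingHom.id_apply]; module)

lemma gammaSesq_apply (L : (X → ℂ) →ₗ[ℂ] (X → ℂ)) (a b : X → ℂ) :
    gammaSesq L a b = Gammac L a b := rfl

/-- The iterated carré du champ as a sesquilinear map. -/
noncomputable def gamma2Sesq (L : (X → ℂ) →ₗ[ℂ] (X → ℂ)) :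
    (X → ℂ) →ₗ⋆[ℂ] (X → ℂ) →ₗ[ℂ] (X → ℂ) :=
  LinearMap.mk₂'ₛₗ (starRingEnd ℂ) (RingHom.id ℂ) (Gamma2c L)
    (fun a a' b => by
      simp only [Gamma2c, ← gammaSesq_apply, map_add, LinearMap.add_apply]; module)
    (fun c a b => by
      simp only [Gamma2c, ← gammaSesq_apply, map_smul, map_smulₛₗ, LinearMap.smul_apply]; module)
    (fun a b b' => by simp only [Gamma2c, ← gammaSesq_apply, map_add]; module)
    (fun c a b => by
      simp only [Gamma2c, ← gammaSesq_apply, map_smul, RingHom.id_apply]; module)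

/-- The difference of the two sides of the Bakry–Émery inequality at the point `x`, as a
sesquilinear form. -/
noncomputable def bakryEmeryForm (L : (X → ℂ) →ₗ[ℂ] (X → ℂ)) (K ν : ℝ) (x : X) :
    (X → ℂ) →ₗ⋆[ℂ] (X → ℂ) →ₗ[ℂ] ℂ :=
  LinearMap.mk₂'ₛₗ (starRingEnd ℂ) (RingHom.id ℂ)
    (fun a b => gamma2Sesq L a b x - (K * gammaSesq L a b x + ν * (star (L a x) * L b x)))
    (fun a a' b => by simp only [map_add, LinearMap.add_apply, Pi.add_apply, star_add]; ring)
    (fun c a b => by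
      simp only [map_smul, map_smulₛₗ, LinearMap.smul_apply, Pi.smul_apply, smul_eq_mul, star_mul',
        starRingEnd_apply]
      ring)
    (fun a b b' => by simp only [map_add, Pi.add_apply]; ring)
    (fun c a b => by
      simp only [map_smul, Pi.smul_apply, smul_eq_mul, RingHom.id_apply]; ring)

lemma bakryEmeryForm_apply (L : (X → ℂ) →ₗ[ℂ] (X → ℂ)) (K ν : ℝ) (x : X) (a b : X → ℂ) :
    bakryEmeryForm L K ν x a b =
      Gamma2c L a b x - (K * Gammac L a b x + ν * (star (L a x) * L b x)) := rfl

lemma BEc.isNonneg_bakryEmeryForm {L : (X → ℂ) →ₗ[ℂ] (X → ℂ)} {K ν : ℝ} (h : BEc L K ν)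
    (x : X) : (bakryEmeryForm L K ν x).IsNonneg where
  nonneg f := sub_nonneg.mpr (h f x)

/-- On a finite set `X` with a strictly positive probability weight
`μ`, a quantum Markov semigroup on the commutative algebra `ℂ^X` satisfying `BE(K,N)`
also satisfies the complete condition `CBE(K,N)`: for all `f₁,…,f_m` and every `x ∈ X`,
`[Γ₂(fⱼ,fₖ)(x)] ≥ K·[Γ(fⱼ,fₖ)(x)] + (1/N)·[conj((Lfⱼ)(x))·(Lfₖ)(x)]` as `m×m` matrices. -/
theorem CBE_of_BE_commutative (Q : QMSc X) (μ : X → ℝ)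
    (hμ : ∀ x, 0 < μ x) (hμ1 : ∑ x, μ x = 1)
    (K : ℝ) (N : ℝ≥0∞) (hN : 0 < N) (hBE : BEc Q.gen K N⁻¹.toReal) :
    ∀ (m : ℕ) (f : Fin m → (X → ℂ)) (x : X),
      (Matrix.of (fun j k : Fin m => Gamma2c Q.gen (f j) (f k) x) -
        (K • Matrix.of (fun j k : Fin m => Gammac Q.gen (f j) (f k) x) +
         N⁻¹.toReal • Matrix.of (fun j k : Fin m =>
            star (Q.gen (f j) x) * Q.gen (f k) x))).PosSemidef := by
  intro m f x
  convert posSemidef_gram_of_isNonneg (hBE.isNonneg_bakryEmeryForm x) f using 1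
  ext j k
  simp [bakryEmeryForm_apply]

end CDComm
end
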